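/- arXiv:1902.06101 — 2 statements merged into one kernel-verified Lean document; each statement's English description precedes it below -/
import Mathlib

section
/- Let f_1, …, f_N : ℝ^d → ℝ be convex differentiable functions with ‖∇f_i(x)‖ ≤ G for all x and all i, let x* be a minimizer of Σ_{i=1}^N f_i, fix c > 0 and set η_k = 1/(c√k). Define iterates by x_i^{k+1} = x̄^k − η_{k+1}∇f_i(x̄^k), where x̄^k = (1/N)Σ_{i=1}^N x_i^k. Then the iterates remain bounded relative to x*: for every K ≥ 1 and every k with 1 ≤ k ≤ K, Σ_{i=1}^N ‖x_i^k − x*‖² ≤ Σ_{i=1}^N ‖x_i^0 − x*‖² + ((log K + 1)/c²) · N G². -/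
open scoped BigOperators

/-- First-order characterization of convexity: a convex function lies above its tangent planes. -/
theorem ConvexOn.add_inner_gradient_le {E : Type*} [NormedAddCommGroup E]
    [InnerProductSpace ℝ E] [CompleteSpace E] {f : E → ℝ} {g x : E}
    (hf : ConvexOn ℝ Set.univ f) (hg : HasGradientAt f g x) (y : E) :
    f x + inner ℝ g (y - x) ≤ f y := by
  have hconv : ConvexOn ℝ Set.univ (f ∘ AffineMap.lineMap (k := ℝ) x y) := by
    simpa using hf.comp_affineMap (AffineMap.lineMap (k := ℝ) x y)
  have hline : HasDerivAt (AffineMap.lineMap (k := ℝ) x y) (y - x) (0 : ℝ) :=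
    AffineMap.hasDerivAt_lineMap
  have hg' : HasFDerivAt f (InnerProductSpace.toDual ℝ E g)
      (AffineMap.lineMap (k := ℝ) x y (0 : ℝ)) := by
    simpa using hg.hasFDerivAt
  have hderiv := hg'.comp_hasDerivAt (0 : ℝ) hline
  have hslope := hconv.le_slope_of_hasDerivAt (Set.mem_univ 0) (Set.mem_univ 1)
    zero_lt_one hderiv
  simp [slope_def_field] at hslope
  linarith

/-- The mean of finitely many points is at least as close to a point `a`, in mean square, as the
points themselves. -/
theorem card_mul_norm_mean_sub_sq_le {E : Type*} [NormedAddCommGroup E] [NormedSpace ℝ E]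
    {N : ℕ} (hN : 0 < N) (x : Fin N → E) (a : E) :
    N * ‖(N : ℝ)⁻¹ • ∑ j, x j - a‖ ^ 2 ≤ ∑ j, ‖x j - a‖ ^ 2 := by
  have hN' : (0 : ℝ) < N := by exact_mod_cast hN
  have hmean : (N : ℝ)⁻¹ • ∑ j, x j - a = (N : ℝ)⁻¹ • ∑ j, (x j - a) := by
    simp [Finset.sum_sub_distrib, smul_sub, ← Nat.cast_smul_eq_nsmul ℝ, smul_smul, hN'.ne']
  have hsq : ‖∑ j, (x j - a)‖ ^ 2 ≤ N * ∑ j, ‖x j - a‖ ^ 2 :=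
    calc ‖∑ j, (x j - a)‖ ^ 2 ≤ (∑ j, ‖x j - a‖) ^ 2 := by
          gcongr
          exact norm_sum_le _ _
      _ ≤ N * ∑ j, ‖x j - a‖ ^ 2 := by
          simpa using sq_sum_le_card_mul_sum_sq (s := Finset.univ) (f := fun j => ‖x j - a‖)
  rw [hmean, norm_smul, mul_pow, Real.norm_of_nonneg (by positivity)]
  calc (N : ℝ) * ((N : ℝ)⁻¹ ^ 2 * ‖∑ j, (x j - a)‖ ^ 2)
      = (N : ℝ)⁻¹ * ‖∑ j, (x j - a)‖ ^ 2 := by field_simp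
    _ ≤ (N : ℝ)⁻¹ * (N * ∑ j, ‖x j - a‖ ^ 2) := by gcongr
    _ = ∑ j, ‖x j - a‖ ^ 2 := by field_simp

/-- If all functions take a gradient step of size `η` from a common point `m`, the total squared
distance to a minimizer `a` of their sum grows by at most `η ^ 2 * (N * G ^ 2)`. -/
theorem sum_norm_gradient_step_sub_sq_le {E : Type*} [NormedAddCommGroup E]
    [InnerProductSpace ℝ E] [CompleteSpace E] {N : ℕ} {f : Fin N → E → ℝ} {g : Fin N → E}
    {m a : E} {G η : ℝ} (hconv : ∀ i, ConvexOn ℝ Set.univ (f i))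
    (hgrad : ∀ i, HasGradientAt (f i) (g i) m) (hG : ∀ i, ‖g i‖ ≤ G)
    (ha : ∑ i, f i a ≤ ∑ i, f i m) (hη : 0 ≤ η) :
    ∑ i, ‖m - η • g i - a‖ ^ 2 ≤ N * ‖m - a‖ ^ 2 + η ^ 2 * (N * G ^ 2) := by
  have hstep (i : Fin N) : ‖m - η • g i - a‖ ^ 2 ≤
      ‖m - a‖ ^ 2 + 2 * η * (f i a - f i m) + η ^ 2 * G ^ 2 := by
    have htangent := (hconv i).add_inner_gradient_le (hgrad i) a
    have hflip : inner ℝ (m - a) (g i) = -inner ℝ (g i) (a - m) := by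
      rw [real_inner_comm, ← inner_neg_right, neg_sub]
    have hinner : η * inner ℝ (g i) (a - m) ≤ η * (f i a - f i m) :=
      mul_le_mul_of_nonneg_left (by linarith) hη
    have hnorm : η ^ 2 * ‖g i‖ ^ 2 ≤ η ^ 2 * G ^ 2 := by
      gcongr
      exact hG i
    rw [sub_right_comm, norm_sub_sq_real, inner_smul_right, hflip, norm_smul, mul_pow,
      Real.norm_of_nonneg hη]
    linarith
  have hdecrease : η * (∑ i, f i a - ∑ i, f i m) ≤ 0 :=
    mul_nonpos_of_nonneg_of_nonpos hη (by linarith)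
  refine (Finset.sum_le_sum fun i _ => hstep i).trans ?_
  simp only [Finset.sum_add_distrib, ← Finset.mul_sum, Finset.sum_sub_distrib, Finset.sum_const,
    Finset.card_univ, Fintype.card_fin, nsmul_eq_mul]
  linarith

/- STATEMENT 13: iterate-boundedness for decentralized GD with diminishing step sizes
   η_k = 1/(c√k).  f₁,…,f_N convex differentiable with ‖∇fᵢ(x)‖ ≤ G, x* a minimizer of
   Σᵢ fᵢ, updates xᵢ^{k+1} = x̄^k − η_{k+1}∇fᵢ(x̄^k).  Then for every K ≥ 1 and every
   1 ≤ k ≤ K, Σᵢ‖xᵢ^k−x*‖² ≤ Σᵢ‖xᵢ⁰−x*‖² + ((log K + 1)/c²)·N·G². -/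
theorem stmt_13 (d N : ℕ) (hN : 0 < N)
    (f : Fin N → EuclideanSpace ℝ (Fin d) → ℝ)
    (g : Fin N → EuclideanSpace ℝ (Fin d) → EuclideanSpace ℝ (Fin d))
    (hconv : ∀ i, ConvexOn ℝ Set.univ (f i))
    (hgrad : ∀ i x, HasGradientAt (f i) (g i x) x)
    (G : ℝ) (hG : ∀ i x, ‖g i x‖ ≤ G)
    (xstar : EuclideanSpace ℝ (Fin d))
    (hstar : ∀ y, (∑ i, f i xstar) ≤ ∑ i, f i y)
    (c : ℝ) (hc : 0 < c)
    (x : ℕ → Fin N → EuclideanSpace ℝ (Fin d))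
    (hupd : ∀ k i, x (k + 1) i =
      ((N : ℝ)⁻¹ • ∑ j, x k j)
        - (1 / (c * Real.sqrt (k + 1))) • g i ((N : ℝ)⁻¹ • ∑ j, x k j))
    (K k : ℕ) (hk1 : 1 ≤ k) (hkK : k ≤ K) :
    (∑ i, ‖x k i - xstar‖ ^ 2) ≤
      (∑ i, ‖x 0 i - xstar‖ ^ 2) + ((Real.log K + 1) / c ^ 2) * N * G ^ 2 := by
  have hharm (n : ℕ) : ∑ i, ‖x n i - xstar‖ ^ 2 ≤
      ∑ i, ‖x 0 i - xstar‖ ^ 2 + ((harmonic n : ℝ) / c ^ 2) * N * G ^ 2 := by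
    induction n with
    | zero => simp
    | succ n ih =>
      have hstep := sum_norm_gradient_step_sub_sq_le (η := 1 / (c * Real.sqrt (n + 1))) hconv
        (fun i => hgrad i ((N : ℝ)⁻¹ • ∑ j, x n j)) (fun i => hG i _) (hstar _) (by positivity)
      have hmean := card_mul_norm_mean_sub_sq_le hN (x n) xstar
      have hη : (1 / (c * Real.sqrt (n + 1))) ^ 2 = ((n : ℝ) + 1)⁻¹ / c ^ 2 := by
        rw [div_pow, mul_pow, Real.sq_sqrt (by positivity)]
        field_simp
      have hsplit : ((harmonic (n + 1) : ℝ) / c ^ 2) * N * G ^ 2 =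
          ((harmonic n : ℝ) / c ^ 2) * N * G ^ 2 + ((n : ℝ) + 1)⁻¹ / c ^ 2 * (N * G ^ 2) := by
        rw [harmonic_succ]
        push_cast
        ring
      simp only [hupd n]
      rw [hη] at hstep
      linarith
  refine (hharm k).trans ?_
  have hk : (0 : ℝ) < k := by exact_mod_cast hk1
  have hlog : (harmonic k : ℝ) ≤ Real.log K + 1 :=
    calc (harmonic k : ℝ) ≤ 1 + Real.log k := harmonic_le_one_add_log k
      _ ≤ 1 + Real.log K := by gcongr
      _ = Real.log K + 1 := add_comm _ _
  gcongr
end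

section
/- Let f : ℝ^d → ℝ be differentiable, m-strongly convex (i.e. (x−y)ᵀ(∇f(x)−∇f(y)) ≥ m‖x−y‖² for all x, y) with global minimizer x*, and have coordinate-Lipschitz gradient with constant M̂ > 0: for every coordinate l, every x and every t ∈ ℝ, |∇f(x + t e_l)[l] − ∇f(x)[l]| ≤ M̂ |t|. Then for every x ∈ ℝ^d, (1/d) Σ_{l=1}^{d} f(x − (1/M̂)·∇f(x)[l]·e_l) − f(x*) ≤ (1 − m/(d M̂)) (f(x) − f(x*)). -/
open scoped InnerProductSpace BigOperators

/-- If the derivative of `φ` grows at most linearly with slope `c` on `[0, 1]`, then `φ 1` is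
bounded by the corresponding quadratic model at `0`. -/
theorem le_quadratic_of_deriv_le_linear {φ φ' : ℝ → ℝ} {c : ℝ}
    (hφ : ∀ t, HasDerivAt φ (φ' t) t)
    (h : ∀ t, 0 < t → φ' t - φ' 0 ≤ c * t) :
    φ 1 ≤ φ 0 + φ' 0 + c / 2 := by
  have hd : ∀ t, HasDerivAt (fun t => φ t - φ' 0 * t - c / 2 * t ^ 2)
      (φ' t - φ' 0 - c * t) t := fun t => by
    refine (((hφ t).sub ((hasDerivAt_id t).const_mul (φ' 0))).sub
      ((hasDerivAt_pow 2 t).const_mul (c / 2))).congr_deriv ?_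
    simp
    ring
  have hanti : AntitoneOn (fun t => φ t - φ' 0 * t - c / 2 * t ^ 2) (Set.Icc 0 1) := by
    refine antitoneOn_of_deriv_nonpos (convex_Icc 0 1)
      (fun t _ => (hd t).continuousAt.continuousWithinAt)
      (fun t _ => (hd t).differentiableAt.differentiableWithinAt) fun t ht => ?_
    rw [interior_Icc] at ht
    rw [(hd t).deriv]
    linarith [h t ht.1]
  have := hanti (Set.left_mem_Icc.2 zero_le_one) (Set.right_mem_Icc.2 zero_le_one) zero_le_one
  norm_num at this
  linarith

section Gradient

variable {E : Type*} [NormedAddCommGroup E] [InnerProductSpace ℝ E] [CompleteSpace E]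
  {f : E → ℝ} {g : E → E}

theorem hasDerivAt_comp_line (hgrad : ∀ x, HasGradientAt f (g x) x) (x v : E) (t : ℝ) :
    HasDerivAt (fun t : ℝ => f (x + t • v)) ⟪g (x + t • v), v⟫_ℝ t := by
  have hline : HasDerivAt (fun t : ℝ => x + t • v) v t := by
    simpa using ((hasDerivAt_id t).smul_const v).const_add x
  exact (hgrad (x + t • v)).hasFDerivAt.comp_hasDerivAt t hline

/-- Strong monotonicity of the gradient implies the Polyak–Łojasiewicz inequality. -/
theorem sub_le_norm_gradient_sq_of_strongly_monotone (hgrad : ∀ x, HasGradientAt f (g x) x)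
    {m : ℝ} (hm : 0 < m) (hsc : ∀ x y, m * ‖x - y‖ ^ 2 ≤ ⟪x - y, g x - g y⟫_ℝ) (x y : E) :
    f x - f y ≤ ‖g x‖ ^ 2 / (2 * m) := by
  have hquad := le_quadratic_of_deriv_le_linear (c := -(m * ‖y - x‖ ^ 2))
    (fun t => (hasDerivAt_comp_line hgrad x (y - x) t).neg) fun t ht => by
      have hmono := hsc (x + t • (y - x)) x
      rw [add_sub_cancel_left, norm_smul, Real.norm_of_nonneg ht.le, real_inner_smul_left,
        real_inner_comm, inner_sub_left] at hmono
      simp only [zero_smul, add_zero]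
      refine le_of_mul_le_mul_left ?_ ht
      linarith
  simp only [Pi.neg_apply, one_smul, zero_smul, add_zero, add_sub_cancel] at hquad
  have hsq : 0 ≤ ‖g x + m • (y - x)‖ ^ 2 := sq_nonneg _
  rw [norm_add_sq_real, real_inner_smul_right, norm_smul, Real.norm_of_nonneg hm.le] at hsq
  rw [le_div_iff₀ (by positivity)]
  nlinarith [mul_le_mul_of_nonneg_left hquad hm.le]

end Gradient

/-- Progress of one coordinate descent step with step size `M⁻¹`. -/
theorem coordinate_step_le {d : ℕ} {f : EuclideanSpace ℝ (Fin d) → ℝ}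
    {g : EuclideanSpace ℝ (Fin d) → EuclideanSpace ℝ (Fin d)}
    (hgrad : ∀ x, HasGradientAt f (g x) x) {M : ℝ} (hM : 0 < M)
    {l : Fin d} {x : EuclideanSpace ℝ (Fin d)}
    (hcoord : ∀ t : ℝ, |g (x + t • EuclideanSpace.single l (1 : ℝ)) l - g x l| ≤ M * |t|) :
    f (x - (M⁻¹ * g x l) • EuclideanSpace.single l (1 : ℝ)) ≤ f x - g x l ^ 2 / (2 * M) := by
  set s : ℝ := -(M⁻¹ * g x l) with hs
  have hgs : g x l = -(M * s) := by rw [hs]; field_simp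
  have hquad := le_quadratic_of_deriv_le_linear (c := M * s ^ 2)
    (hasDerivAt_comp_line hgrad x (s • EuclideanSpace.single l (1 : ℝ))) fun t ht => by
      have hle := hcoord (t * s)
      simp only [smul_smul, inner_smul_right, EuclideanSpace.inner_single_right, zero_mul,
        zero_smul, add_zero, one_mul, conj_trivial, ← mul_sub]
      calc _ ≤ |s| * |g (x + (t * s) • EuclideanSpace.single l (1 : ℝ)) l - g x l| := by
            rw [← abs_mul]; exact le_abs_self _
        _ ≤ |s| * (M * |t * s|) := by gcongr
        _ = M * s ^ 2 * t := by rw [abs_mul, abs_of_pos ht, ← sq_abs s]; ring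
  simp only [inner_smul_right, EuclideanSpace.inner_single_right, zero_smul, add_zero, one_smul,
    one_mul, conj_trivial] at hquad
  rw [sub_eq_add_neg, ← neg_smul, ← hs]
  refine hquad.trans_eq ?_
  rw [hgs]
  field_simp
  ring

/- STATEMENT 16: f : ℝ^d → ℝ differentiable, m-strongly convex
   (⟨x−y, ∇f(x)−∇f(y)⟩ ≥ m‖x−y‖²) with global minimizer x*, and with
   coordinate-Lipschitz gradient with constant M̂ > 0.  Then for every x,
   (1/d) Σ_l f(x − (1/M̂)∇f(x)[l] e_l) − f(x*) ≤ (1 − m/(dM̂))(f(x) − f(x*)). -/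
theorem stmt_16 (d : ℕ) (hd : 0 < d)
    (f : EuclideanSpace ℝ (Fin d) → ℝ)
    (g : EuclideanSpace ℝ (Fin d) → EuclideanSpace ℝ (Fin d))
    (hgrad : ∀ x, HasGradientAt f (g x) x)
    (m : ℝ) (hm : 0 < m)
    (hsc : ∀ (x y : EuclideanSpace ℝ (Fin d)),
      m * ‖x - y‖ ^ 2 ≤ ⟪x - y, g x - g y⟫_ℝ)
    (xstar : EuclideanSpace ℝ (Fin d)) (hstar : ∀ y, f xstar ≤ f y)
    (Mhat : ℝ) (hM : 0 < Mhat)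
    (hcoord : ∀ (l : Fin d) (x : EuclideanSpace ℝ (Fin d)) (t : ℝ),
      |g (x + t • EuclideanSpace.single l (1 : ℝ)) l - g x l| ≤ Mhat * |t|)
    (x : EuclideanSpace ℝ (Fin d)) :
    (d : ℝ)⁻¹ * (∑ l, f (x - (Mhat⁻¹ * g x l) • EuclideanSpace.single l (1 : ℝ)))
        - f xstar ≤
      (1 - m / (d * Mhat)) * (f x - f xstar) := by
  have hd' : (0 : ℝ) < d := Nat.cast_pos.2 hd
  have hsum : ∑ l, f (x - (Mhat⁻¹ * g x l) • EuclideanSpace.single l (1 : ℝ)) ≤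
      d * f x - ‖g x‖ ^ 2 / (2 * Mhat) := by
    refine (Finset.sum_le_sum fun l _ => coordinate_step_le hgrad hM (hcoord l x)).trans_eq ?_
    simp [Finset.sum_sub_distrib, ← Finset.sum_div, EuclideanSpace.real_norm_sq_eq]
  have hPL := sub_le_norm_gradient_sq_of_strongly_monotone hgrad hm hsc x xstar
  calc _ ≤ (d : ℝ)⁻¹ * (d * f x - ‖g x‖ ^ 2 / (2 * Mhat)) - f xstar := by gcongr
    _ = f x - f xstar - m / (d * Mhat) * (‖g x‖ ^ 2 / (2 * m)) := by field_simp; ring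
    _ ≤ f x - f xstar - m / (d * Mhat) * (f x - f xstar) := by gcongr
    _ = _ := by ring
end
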